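/- arXiv:2004.11878 — 2 statements merged into one kernel-verified Lean document; each statement's English description precedes it below -/
import Mathlib

section
/- Fix n ≥ 2, k ∈ (0,1), θ > 0, and let Y_1,…,Y_n be i.i.d. uniform on [θ(1−k), θ(1+k)]. Define φ(s₂) = ((n+1)/n) · ((1+k)^n − ((1−k)/s₂)^n) / ((1+k)^{n+1} − ((1−k)/s₂)^{n+1}). Then E[S_1 | S_2 = s₂] = θ/φ(s₂) for almost every s₂, and consequently the estimator T = φ(S_2)·S_1 is unbiased: E[φ(Y_(1)/Y_(n)) · Y_(n)] = θ for every θ > 0. -/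
open MeasureTheory

/-- The uniform probability distribution on the interval `[a, b]`. -/
noncomputable def unifIcc (a b : ℝ) : Measure ℝ :=
  (ENNReal.ofReal (b - a))⁻¹ • volume.restrict (Set.Icc a b)

/-- `φ(s₂) = ((n+1)/n) ((1+k)^n − ((1−k)/s₂)^n) / ((1+k)^(n+1) − ((1−k)/s₂)^(n+1))`. -/
noncomputable def phi (n : ℕ) (k s₂ : ℝ) : ℝ :=
  ((n + 1 : ℝ) / n) * ((1 + k) ^ n - ((1 - k) / s₂) ^ n)
    / ((1 + k) ^ (n + 1) - ((1 - k) / s₂) ^ (n + 1))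

/-- Generalized polar coordinates for the lower Lebesgue integral. -/
lemma lintegral_eq_lintegral_toSphere {E : Type*} [NormedAddCommGroup E] [NormedSpace ℝ E]
    [Nontrivial E] [MeasurableSpace E] [BorelSpace E] [FiniteDimensional ℝ E]
    (μ : Measure E) [μ.IsAddHaarMeasure] {f : E → ENNReal} (hf : Measurable f) :
    ∫⁻ x, f x ∂μ = ∫⁻ ω, (∫⁻ r in Set.Ioi (0 : ℝ),
      ENNReal.ofReal (r ^ (Module.finrank ℝ E - 1)) * f (r • (ω : E))) ∂μ.toSphere := by
  have hF : Measurable fun p : Metric.sphere (0 : E) 1 × Set.Ioi (0 : ℝ) =>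
      f ((p.2 : ℝ) • (p.1 : E)) := by fun_prop
  calc
    ∫⁻ x, f x ∂μ = ∫⁻ x : ({(0)}ᶜ : Set E), f x ∂(μ.comap (↑)) := by
      rw [lintegral_subtype_comap (measurableSet_singleton _).compl, restrict_compl_singleton]
    _ = ∫⁻ p, f ((p.2 : ℝ) • (p.1 : E))
          ∂μ.toSphere.prod (.volumeIoiPow (Module.finrank ℝ E - 1)) := by
      rw [← μ.measurePreserving_homeomorphUnitSphereProd.lintegral_comp hF]
      refine lintegral_congr fun x => ?_
      have hx : ‖(x : E)‖ ≠ 0 := norm_ne_zero_iff.2 x.2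
      simp [smul_smul, hx]
    _ = _ := by
      rw [lintegral_prod _ hF.aemeasurable]
      refine lintegral_congr fun ω => ?_
      rw [Measure.volumeIoiPow, lintegral_withDensity_eq_lintegral_mul _ (by fun_prop)
        (by fun_prop)]
      exact lintegral_subtype_comap measurableSet_Ioi fun r : ℝ =>
        ENNReal.ofReal (r ^ (Module.finrank ℝ E - 1)) * f (r • (ω : E))

lemma setLIntegral_Icc_pow {u b : ℝ} (hu : 0 ≤ u) (hub : u ≤ b) (m : ℕ) :
    ∫⁻ r in Set.Icc u b, ENNReal.ofReal (r ^ m)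
      = ENNReal.ofReal ((b ^ (m + 1) - u ^ (m + 1)) / (m + 1)) := by
  rw [← ofReal_integral_eq_lintegral_ofReal, integral_Icc_eq_integral_Ioc,
    ← intervalIntegral.integral_of_le hub, integral_pow]
  · exact (continuous_pow m).continuousOn.integrableOn_Icc
  · filter_upwards [ae_restrict_mem measurableSet_Icc] with r hr
    exact pow_nonneg (hu.trans hr.1) _

lemma setLIntegral_Icc_pow_mul {u b : ℝ} (hu : 0 < u) {n : ℕ} (hn : n ≠ 0) :
    ∫⁻ r in Set.Icc u b, ENNReal.ofReal (r ^ (n - 1)) * ENNReal.ofReal r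
      = ENNReal.ofReal (n / (n + 1) * ((b ^ (n + 1) - u ^ (n + 1)) / (b ^ n - u ^ n)))
        * ∫⁻ r in Set.Icc u b, ENNReal.ofReal (r ^ (n - 1)) := by
  obtain ⟨m, rfl⟩ := Nat.exists_eq_succ_of_ne_zero hn
  rcases lt_or_ge b u with h | h
  · simp [Set.Icc_eq_empty (not_le.2 h)]
  rcases h.eq_or_lt with rfl | h'
  · simp
  have h1 : ∫⁻ r in Set.Icc u b, ENNReal.ofReal (r ^ (m.succ - 1)) * ENNReal.ofReal r
      = ∫⁻ r in Set.Icc u b, ENNReal.ofReal (r ^ (m + 1)) := by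
    refine setLIntegral_congr_fun measurableSet_Icc fun r hr => ?_
    have hr0 : 0 ≤ r := hu.le.trans hr.1
    simp only [Nat.succ_sub_one]
    rw [← ENNReal.ofReal_mul (by positivity), pow_succ]
  have hA : 0 < b ^ (m + 1) - u ^ (m + 1) :=
    sub_pos.2 (pow_lt_pow_left₀ h' hu.le (by simp))
  have hB : 0 < b ^ (m + 1 + 1) - u ^ (m + 1 + 1) :=
    sub_pos.2 (pow_lt_pow_left₀ h' hu.le (by simp))
  rw [h1, setLIntegral_Icc_pow hu.le h, Nat.succ_sub_one, setLIntegral_Icc_pow hu.le h,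
    ← ENNReal.ofReal_mul (by simp only [Nat.succ_eq_add_one]; positivity)]
  congr 1
  simp only [Nat.succ_eq_add_one]
  push_cast
  field_simp

lemma mem_pi_Icc_iff {n : ℕ} (hn : n ≠ 0) {a b : ℝ} {y : Fin n → ℝ} :
    y ∈ Set.univ.pi (fun _ => Set.Icc a b) ↔ a ≤ ⨅ i, y i ∧ ⨆ i, y i ≤ b := by
  have : Nonempty (Fin n) := Fin.pos_iff_nonempty.1 (Nat.pos_of_ne_zero hn)
  rw [le_ciInf_iff (Set.finite_range _).bddBelow, ciSup_le_iff (Set.finite_range _).bddAbove]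
  simp only [Set.mem_pi, Set.mem_univ, true_imp_iff, Set.mem_Icc, forall_and]

lemma iSup_eq_norm_of_nonneg {n : ℕ} {y : Fin n → ℝ} (hy : ∀ i, 0 ≤ y i) :
    ⨆ i, y i = ‖y‖ := by
  refine le_antisymm (Real.iSup_le (fun i => (le_abs_self _).trans (norm_le_pi_norm y i))
    (norm_nonneg _)) ?_
  refine (pi_norm_le_iff_of_nonneg (Real.iSup_nonneg hy)).2 fun i => ?_
  rw [Real.norm_of_nonneg (hy i)]
  exact le_ciSup (Set.finite_range _).bddAbove i

/-- Under Lebesgue measure on the cube `[a, b]ⁿ`, the maximum may be replaced by an explicit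
function of the ratio of the minimum to the maximum. -/
lemma setLIntegral_iSup_eq {n : ℕ} (hn : n ≠ 0) {a b : ℝ} (ha : 0 < a)
    {h : ℝ → ENNReal} (hh : Measurable h) :
    ∫⁻ y in Set.univ.pi (fun _ : Fin n => Set.Icc a b),
        h ((⨅ i, y i) / (⨆ i, y i)) * ENNReal.ofReal (⨆ i, y i)
      = ∫⁻ y in Set.univ.pi (fun _ : Fin n => Set.Icc a b),
        h ((⨅ i, y i) / (⨆ i, y i)) * ENNReal.ofReal (n / (n + 1) *
          ((b ^ (n + 1) - (a / ((⨅ i, y i) / (⨆ i, y i))) ^ (n + 1))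
            / (b ^ n - (a / ((⨅ i, y i) / (⨆ i, y i))) ^ n))) := by
  have : Nonempty (Fin n) := Fin.pos_iff_nonempty.1 (Nat.pos_of_ne_zero hn)
  have hbox : MeasurableSet (Set.univ.pi (fun _ : Fin n => Set.Icc a b)) :=
    MeasurableSet.univ_pi fun _ => measurableSet_Icc
  rw [← lintegral_indicator hbox, ← lintegral_indicator hbox,
    lintegral_eq_lintegral_toSphere volume (Measurable.indicator (by fun_prop) hbox),
    lintegral_eq_lintegral_toSphere volume (Measurable.indicator (by fun_prop) hbox)]
  refine lintegral_congr fun ω => ?_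
  obtain ⟨ω, hω⟩ := ω
  rw [Module.finrank_fin_fun]
  rcases le_or_gt (⨅ i, ω i) 0 with ht | ht
  · refine setLIntegral_congr_fun measurableSet_Ioi fun r (hr : 0 < r) => ?_
    have hnot : r • ω ∉ Set.univ.pi (fun _ : Fin n => Set.Icc a b) := by
      rw [mem_pi_Icc_iff hn]
      rintro ⟨h1, -⟩
      have h2 : ⨅ i, (r • ω) i = r * ⨅ i, ω i := by
        simp [Real.mul_iInf_of_nonneg hr.le]
      nlinarith
    simp only [Set.indicator_of_notMem hnot]
  set t := ⨅ i, ω i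
  have hsup : ⨆ i, ω i = 1 := by
    rw [iSup_eq_norm_of_nonneg fun i => ht.le.trans (ciInf_le (Set.finite_range _).bddBelow i)]
    simpa using hω
  have key : ∀ F : ℝ → ℝ → ENNReal,
      ∫⁻ r in Set.Ioi (0 : ℝ), ENNReal.ofReal (r ^ (n - 1)) *
        (Set.univ.pi (fun _ : Fin n => Set.Icc a b)).indicator
          (fun y => F ((⨅ i, y i) / (⨆ i, y i)) (⨆ i, y i)) (r • ω)
      = ∫⁻ r in Set.Icc (a / t) b, ENNReal.ofReal (r ^ (n - 1)) * F t r := by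
    intro F
    have hsub : Set.Icc (a / t) b ⊆ Set.Ioi 0 := fun r hr => (div_pos ha ht).trans_le hr.1
    rw [← Set.inter_eq_self_of_subset_left hsub, ← setLIntegral_indicator measurableSet_Icc]
    refine setLIntegral_congr_fun measurableSet_Ioi fun r (hr : 0 < r) => ?_
    have h1 : ⨅ i, (r • ω) i = r * t := by simp [t, Real.mul_iInf_of_nonneg hr.le]
    have h2 : ⨆ i, (r • ω) i = r := by
      simp only [Pi.smul_apply, smul_eq_mul]
      rw [← Real.mul_iSup_of_nonneg hr.le, hsup, mul_one]
    have hmem : r • ω ∈ Set.univ.pi (fun _ : Fin n => Set.Icc a b) ↔ r ∈ Set.Icc (a / t) b := by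
      rw [mem_pi_Icc_iff hn, h1, h2, Set.mem_Icc, div_le_iff₀ ht]
    by_cases hr' : r ∈ Set.Icc (a / t) b
    · rw [Set.indicator_of_mem (hmem.2 hr'), Set.indicator_of_mem hr', h1, h2,
        mul_div_cancel_left₀ _ hr.ne']
    · rw [Set.indicator_of_notMem (mt hmem.1 hr'), Set.indicator_of_notMem hr', mul_zero]
  rw [key fun s M => h s * ENNReal.ofReal M, key fun s _ => h s * ENNReal.ofReal (n / (n + 1) *
    ((b ^ (n + 1) - (a / s) ^ (n + 1)) / (b ^ n - (a / s) ^ n)))]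
  simp_rw [mul_left_comm _ (h t)]
  rw [lintegral_const_mul _ (by fun_prop), lintegral_const_mul _ (by fun_prop),
    setLIntegral_Icc_pow_mul (div_pos ha ht) hn, lintegral_mul_const _ (by fun_prop), mul_comm
    (ENNReal.ofReal _)]

lemma isProbabilityMeasure_unifIcc {a b : ℝ} (hab : a < b) :
    IsProbabilityMeasure (unifIcc a b) := by
  refine ⟨?_⟩
  simp only [unifIcc, Measure.smul_apply, Measure.restrict_apply_univ, Real.volume_Icc,
    smul_eq_mul]
  exact ENNReal.inv_mul_cancel (by simpa using hab) ENNReal.ofReal_ne_top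

lemma pi_unifIcc (n : ℕ) {a b : ℝ} (hab : a < b) :
    (Measure.pi fun _ : Fin n => unifIcc a b)
      = ((ENNReal.ofReal (b - a))⁻¹) ^ n •
        volume.restrict (Set.univ.pi fun _ : Fin n => Set.Icc a b) := by
  have := isProbabilityMeasure_unifIcc hab
  refine Measure.pi_eq fun s _ => ?_
  rw [volume_pi, Measure.restrict_pi_pi]
  simp [unifIcc, Measure.pi_pi, Finset.prod_mul_distrib]

lemma ae_pi_unifIcc (n : ℕ) {a b : ℝ} (hab : a < b) :
    ∀ᵐ y ∂(Measure.pi fun _ : Fin n => unifIcc a b), ∀ i, a < y i ∧ y i ≤ b := by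
  have := isProbabilityMeasure_unifIcc hab
  refine ae_all_iff.2 fun i => ?_
  have h : ∀ᵐ x ∂(unifIcc a b), a < x ∧ x ≤ b := by
    refine Measure.ae_smul_measure ?_ _
    rw [Measure.restrict_congr_set Ioc_ae_eq_Icc.symm]
    exact ae_restrict_mem measurableSet_Ioc
  exact (Measure.quasiMeasurePreserving_eval (fun _ : Fin n => unifIcc a b) i).ae h

lemma div_phi_eq {n : ℕ} (hn : n ≠ 0) {k θ s : ℝ} (hθ : 0 < θ) :
    θ / phi n k s = n / (n + 1) *
      (((θ * (1 + k)) ^ (n + 1) - (θ * (1 - k) / s) ^ (n + 1))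
        / ((θ * (1 + k)) ^ n - (θ * (1 - k) / s) ^ n)) := by
  have hn' : (n : ℝ) ≠ 0 := Nat.cast_ne_zero.2 hn
  have hn1 : (n + 1 : ℝ) ≠ 0 := by positivity
  simp only [phi, mul_div_assoc θ, mul_pow θ, ← mul_sub]
  generalize (1 + k) ^ n - ((1 - k) / s) ^ n = A
  generalize (1 + k) ^ (n + 1) - ((1 - k) / s) ^ (n + 1) = B
  by_cases hA : A = 0
  · simp [hA]
  by_cases hB : B = 0
  · simp [hB]
  field_simp
  ring

lemma phi_pos {n : ℕ} (hn : n ≠ 0) {k s : ℝ} (hk : k < 1) (hs : 0 < s)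
    (hks : 1 - k < s * (1 + k)) : 0 < phi n k s := by
  have h0 : 0 ≤ (1 - k) / s := div_nonneg (by linarith) hs.le
  have h1 : (1 - k) / s < 1 + k := by rwa [div_lt_iff₀' hs]
  have hA : 0 < (1 + k) ^ n - ((1 - k) / s) ^ n := sub_pos.2 (pow_lt_pow_left₀ h1 h0 hn)
  have hB : 0 < (1 + k) ^ (n + 1) - ((1 - k) / s) ^ (n + 1) :=
    sub_pos.2 (pow_lt_pow_left₀ h1 h0 (by simp))
  have : (0 : ℝ) < n := Nat.cast_pos.2 (Nat.pos_of_ne_zero hn)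
  unfold phi
  positivity

lemma measurable_phi (n : ℕ) (k : ℝ) : Measurable (phi n k) := by
  unfold phi
  fun_prop

lemma lintegral_mul_iSup_eq {n : ℕ} (hn : n ≠ 0) {k θ : ℝ} (hk : k ∈ Set.Ioo (0:ℝ) 1)
    (hθ : 0 < θ) {h : ℝ → ENNReal} (hh : Measurable h) :
    ∫⁻ y, h ((⨅ i, y i) / (⨆ i, y i)) * ENNReal.ofReal (⨆ i, y i)
        ∂(Measure.pi fun _ : Fin n => unifIcc (θ * (1 - k)) (θ * (1 + k)))
      = ∫⁻ y, h ((⨅ i, y i) / (⨆ i, y i)) *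
          ENNReal.ofReal (θ / phi n k ((⨅ i, y i) / (⨆ i, y i)))
        ∂(Measure.pi fun _ : Fin n => unifIcc (θ * (1 - k)) (θ * (1 + k))) := by
  have hab : θ * (1 - k) < θ * (1 + k) := by nlinarith [hk.1]
  have ha : 0 < θ * (1 - k) := mul_pos hθ (by linarith [hk.2])
  rw [pi_unifIcc n hab, lintegral_smul_measure, lintegral_smul_measure,
    setLIntegral_iSup_eq hn ha hh]
  simp_rw [div_phi_eq hn hθ]

lemma ae_phi_pos {n : ℕ} (hn : n ≠ 0) {k θ : ℝ} (hk : k ∈ Set.Ioo (0:ℝ) 1) (hθ : 0 < θ) :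
    ∀ᵐ y ∂(Measure.pi fun _ : Fin n => unifIcc (θ * (1 - k)) (θ * (1 + k))),
      0 < phi n k ((⨅ i, y i) / (⨆ i, y i)) ∧ 0 < ⨆ i, y i ∧ ⨆ i, y i ≤ θ * (1 + k) := by
  have : Nonempty (Fin n) := Fin.pos_iff_nonempty.1 (Nat.pos_of_ne_zero hn)
  have hab : θ * (1 - k) < θ * (1 + k) := by nlinarith [hk.1]
  have ha : 0 < θ * (1 - k) := mul_pos hθ (by linarith [hk.2])
  filter_upwards [ae_pi_unifIcc n hab] with y hy
  obtain ⟨i, hi⟩ := exists_eq_ciInf_of_finite (f := y)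
  have hm : θ * (1 - k) < ⨅ i, y i := hi ▸ (hy i).1
  have hM : ⨆ i, y i ≤ θ * (1 + k) := ciSup_le fun i => (hy i).2
  have hmM : ⨅ i, y i ≤ ⨆ i, y i :=
    hi ▸ le_ciSup (f := y) (Set.finite_range _).bddAbove i
  have hM0 : 0 < ⨆ i, y i := by linarith
  refine ⟨phi_pos hn hk.2 (div_pos (ha.trans hm) hM0) ?_, hM0, hM⟩
  rw [div_mul_eq_mul_div, lt_div_iff₀ hM0]
  have h1k : 0 < 1 - k := by linarith [hk.2]
  have h2k : 0 < 1 + k := by linarith [hk.1]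
  refine lt_of_le_of_lt (mul_le_mul_of_nonneg_left hM h1k.le) ?_
  nlinarith

/-- For `Y_1, …, Y_n` i.i.d. uniform on `[θ(1-k), θ(1+k)]`,
`E[S₁ | S₂ = s₂] = θ / φ(s₂)` almost everywhere, and consequently the estimator
`T = φ(S₂) S₁` is unbiased: `E[φ(Y_(1)/Y_(n)) Y_(n)] = θ` for every `θ > 0`. -/
theorem stmt_8 (n : ℕ) (hn : 2 ≤ n) (k : ℝ) (hk : k ∈ Set.Ioo (0:ℝ) 1)
    (θ : ℝ) (hθ : 0 < θ) :
    ((Measure.pi fun _ : Fin n => unifIcc (θ * (1 - k)) (θ * (1 + k)))[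
        (fun y : Fin n → ℝ => ⨆ i, y i) |
        MeasurableSpace.comap (fun y : Fin n → ℝ => (⨅ i, y i) / (⨆ i, y i)) inferInstance]
      =ᵐ[Measure.pi fun _ : Fin n => unifIcc (θ * (1 - k)) (θ * (1 + k))]
      fun y : Fin n → ℝ => θ / phi n k ((⨅ i, y i) / (⨆ i, y i))) ∧
    (∫ y : Fin n → ℝ, phi n k ((⨅ i, y i) / (⨆ i, y i)) * (⨆ i, y i)
        ∂(Measure.pi fun _ : Fin n => unifIcc (θ * (1 - k)) (θ * (1 + k)))) = θ := by
  have hn0 : n ≠ 0 := by omega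
  have : Nonempty (Fin n) := Fin.pos_iff_nonempty.1 (Nat.pos_of_ne_zero hn0)
  have := isProbabilityMeasure_unifIcc (show θ * (1 - k) < θ * (1 + k) by nlinarith [hk.1])
  have hpos := ae_phi_pos hn0 hk hθ
  have key := fun {h : ℝ → ENNReal} (hh : Measurable h) => lintegral_mul_iSup_eq hn0 hk hθ hh
  have hphi := measurable_phi n k
  set μ := Measure.pi fun _ : Fin n => unifIcc (θ * (1 - k)) (θ * (1 + k))
  have hS : Measurable fun y : Fin n → ℝ => (⨅ i, y i) / (⨆ i, y i) := by fun_prop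
  have hM : Measurable fun y : Fin n → ℝ => ⨆ i, y i := by fun_prop
  have hg : Measurable fun y : Fin n → ℝ => θ / phi n k ((⨅ i, y i) / (⨆ i, y i)) :=
    measurable_const.div (hphi.comp hS)
  have hM_nonneg : 0 ≤ᵐ[μ] fun y => ⨆ i, y i := by
    filter_upwards [hpos] with y hy using hy.2.1.le
  have hg_nonneg : 0 ≤ᵐ[μ] fun y => θ / phi n k ((⨅ i, y i) / (⨆ i, y i)) := by
    filter_upwards [hpos] with y hy using div_nonneg hθ.le hy.1.le
  have hM_int : Integrable (fun y : Fin n → ℝ => ⨆ i, y i) μ := by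
    refine Integrable.of_bound hM.aestronglyMeasurable (θ * (1 + k)) ?_
    filter_upwards [hpos] with y hy
    rw [Real.norm_of_nonneg hy.2.1.le]
    exact hy.2.2
  have hg_int : Integrable (fun y => θ / phi n k ((⨅ i, y i) / (⨆ i, y i))) μ := by
    refine (lintegral_ofReal_ne_top_iff_integrable hg.aestronglyMeasurable hg_nonneg).1 ?_
    have h1 := key (h := 1) measurable_const
    simp only [Pi.one_apply, one_mul] at h1
    rw [← h1]
    exact (lintegral_ofReal_ne_top_iff_integrable hM.aestronglyMeasurable hM_nonneg).2 hM_int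
  constructor
  · refine (ae_eq_condExp_of_forall_setIntegral_eq hS.comap_le hM_int
      (fun s _ _ => hg_int.integrableOn) ?_ ?_).symm
    · rintro _ ⟨s, hs, rfl⟩ -
      rw [integral_eq_lintegral_of_nonneg_ae (ae_restrict_of_ae hg_nonneg)
          hg.aestronglyMeasurable,
        integral_eq_lintegral_of_nonneg_ae (ae_restrict_of_ae hM_nonneg) hM.aestronglyMeasurable,
        ← lintegral_indicator (hS hs), ← lintegral_indicator (hS hs)]
      have h1 := key (h := s.indicator 1) (measurable_one.indicator hs)
      have h2 : ∀ (F : (Fin n → ℝ) → ENNReal) (y : Fin n → ℝ),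
          ((fun y : Fin n → ℝ => (⨅ i, y i) / (⨆ i, y i)) ⁻¹' s).indicator F y
            = s.indicator 1 ((⨅ i, y i) / (⨆ i, y i)) * F y := by
        intro F y
        by_cases hy : (⨅ i, y i) / (⨆ i, y i) ∈ s <;> simp [Set.indicator, hy]
      simp_rw [h2]
      rw [h1]
    · exact ((measurable_const.div hphi).comp
        (comap_measurable _)).stronglyMeasurable.aestronglyMeasurable
  · have hT : Measurable fun y : Fin n → ℝ =>
        phi n k ((⨅ i, y i) / (⨆ i, y i)) * (⨆ i, y i) := (hphi.comp hS).mul hM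
    rw [integral_eq_lintegral_of_nonneg_ae
      (by filter_upwards [hpos] with y hy using mul_nonneg hy.1.le hy.2.1.le)
      hT.aestronglyMeasurable]
    have h1 := key (h := fun t => ENNReal.ofReal (phi n k t)) hphi.ennreal_ofReal
    have h2 : ∫⁻ y, ENNReal.ofReal (phi n k ((⨅ i, y i) / (⨆ i, y i)) * (⨆ i, y i)) ∂μ
        = ∫⁻ y, ENNReal.ofReal (phi n k ((⨅ i, y i) / (⨆ i, y i))) *
          ENNReal.ofReal (⨆ i, y i) ∂μ := by
      refine lintegral_congr_ae ?_
      filter_upwards [hpos] with y hy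
      rw [ENNReal.ofReal_mul hy.1.le]
    have h3 : ∫⁻ y, ENNReal.ofReal (phi n k ((⨅ i, y i) / (⨆ i, y i))) *
          ENNReal.ofReal (θ / phi n k ((⨅ i, y i) / (⨆ i, y i))) ∂μ
        = ∫⁻ _, ENNReal.ofReal θ ∂μ := by
      refine lintegral_congr_ae ?_
      filter_upwards [hpos] with y hy
      rw [← ENNReal.ofReal_mul hy.1.le, mul_div_cancel₀ _ hy.1.ne']
    rw [h2, h1, h3]
    simp [μ, hθ.le]
end

section
/- Let n ≥ 1 and 0 < a < b, and let Θ have the truncated Pareto distribution Pareto(n, [a,b]). Then, with b_* = b/a, E[ln Θ] = ln a + 1/n − (ln b_*)/(b_*^n − 1). Consequently the estimator θ̂_SC determined by ln θ̂_SC = E[ln Θ] for the fiducial distribution Pareto(n, [θ̂_ML, θ̂_MU]) equals θ̂_SC = θ̂_ML · exp{1/n − (ln b_*)/(b_*^n − 1)}. -/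
open MeasureTheory

/-- The truncated Pareto distribution `Pareto(α, [a,b])`: the measure on `ℝ` with density
`t ↦ (α/(a^(-α) - b^(-α))) t^(-α-1)` on `[a, b]` and `0` elsewhere. -/
noncomputable def paretoTrunc (α a b : ℝ) : Measure ℝ :=
  volume.withDensity fun t =>
    ENNReal.ofReal
      ((Set.Icc a b).indicator (fun t => α / (a ^ (-α) - b ^ (-α)) * t ^ (-α - 1)) t)

/-- The normalizing constant of the truncated Pareto density is positive. -/
lemma div_rpow_neg_sub_rpow_neg_pos {α a b : ℝ} (hα : α ≠ 0) (ha : 0 < a) (hab : a < b) :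
    0 < α / (a ^ (-α) - b ^ (-α)) := by
  rcases hα.lt_or_gt with h | h
  · exact div_pos_of_neg_of_neg h
      (sub_neg.2 (Real.rpow_lt_rpow ha.le hab (neg_pos.2 h)))
  · exact div_pos h (sub_pos.2 (Real.rpow_lt_rpow_of_neg ha hab (neg_neg_of_pos h)))

/-- Expectations under the truncated Pareto distribution as interval integrals. -/
lemma integral_paretoTrunc {α a b : ℝ} (hα : α ≠ 0) (ha : 0 < a) (hab : a < b) (f : ℝ → ℝ) :
    ∫ t, f t ∂(paretoTrunc α a b)
      = α / (a ^ (-α) - b ^ (-α)) * ∫ t in a..b, t ^ (-α - 1) * f t := by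
  have hc := div_rpow_neg_sub_rpow_neg_pos hα ha hab
  have hmeas : Measurable ((Set.Icc a b).indicator
      fun t : ℝ => α / (a ^ (-α) - b ^ (-α)) * t ^ (-α - 1)) :=
    (Measurable.const_mul (by fun_prop) _).indicator measurableSet_Icc
  rw [paretoTrunc, integral_withDensity_eq_integral_toReal_smul hmeas.ennreal_ofReal
    (Filter.Eventually.of_forall fun _ => ENNReal.ofReal_lt_top),
    intervalIntegral.integral_of_le hab.le, ← integral_Icc_eq_integral_Ioc,
    ← integral_const_mul, ← integral_indicator measurableSet_Icc]
  congr 1 with t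
  by_cases ht : t ∈ Set.Icc a b
  · have htpos : 0 < t := ha.trans_le ht.1
    simp only [Set.indicator_of_mem ht, smul_eq_mul]
    rw [ENNReal.toReal_ofReal (by positivity), mul_assoc]
  · simp [Set.indicator_of_notMem ht]

/-- The log-moment of the power density `t ^ (-α - 1)` on `[a, b]`. -/
lemma integral_rpow_mul_log {α a b : ℝ} (hα : α ≠ 0) (ha : 0 < a) (hab : a ≤ b) :
    ∫ t in a..b, t ^ (-α - 1) * Real.log t
      = (a ^ (-α) * (Real.log a + 1 / α) - b ^ (-α) * (Real.log b + 1 / α)) / α := by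
  have hpos : ∀ t ∈ Set.uIcc a b, 0 < t := fun t ht =>
    ha.trans_le (Set.uIcc_of_le hab ▸ ht).1
  rw [intervalIntegral.integral_eq_sub_of_hasDerivAt
    (f := fun t => -(t ^ (-α) * (Real.log t + 1 / α)) / α)]
  · ring
  · intro t ht
    have h := hpos t ht
    refine (((Real.hasDerivAt_rpow_const (p := -α) (Or.inl h.ne')).mul
      ((Real.hasDerivAt_log h.ne').add_const (1 / α))).neg.div_const α).congr_deriv ?_
    rw [Real.rpow_sub_one h.ne']
    field_simp
    ring
  · refine ContinuousOn.intervalIntegrable fun t ht => ContinuousAt.continuousWithinAt ?_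
    have h := (hpos t ht).ne'
    exact (Real.continuousAt_rpow_const _ _ (Or.inl h)).mul (Real.continuousAt_log h)

/-- The log-expectation of a truncated Pareto distribution. -/
lemma integral_log_paretoTrunc {α a b : ℝ} (hα : α ≠ 0) (ha : 0 < a) (hab : a < b) :
    ∫ t, Real.log t ∂(paretoTrunc α a b)
      = Real.log a + 1 / α - Real.log (b / a) / ((b / a) ^ α - 1) := by
  have hb : 0 < b := ha.trans hab
  have hc := div_rpow_neg_sub_rpow_neg_pos hα ha hab
  rw [integral_paretoTrunc hα ha hab, integral_rpow_mul_log hα ha hab.le]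
  have hd : a ^ (-α) - b ^ (-α) ≠ 0 := fun h => by simp [h] at hc
  rw [Real.log_div hb.ne' ha.ne', Real.div_rpow hb.le ha.le]
  rw [Real.rpow_neg ha.le, Real.rpow_neg hb.le] at *
  have hA : a ^ α ≠ 0 := (Real.rpow_pos_of_pos ha α).ne'
  have hB : b ^ α ≠ 0 := (Real.rpow_pos_of_pos hb α).ne'
  generalize a ^ α = A at *
  generalize b ^ α = B at *
  have hBA : B - A ≠ 0 := fun h => hd (by rw [sub_eq_zero.1 h, sub_self])
  have h₁ : A⁻¹ - B⁻¹ = (B - A) / (A * B) := by field_simp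
  have h₂ : B / A - 1 = (B - A) / A := by field_simp
  rw [h₁, h₂]
  field_simp
  ring

/-- For `Θ ~ Pareto(n, [a,b])` with `n ≥ 1`, `0 < a < b` and `b_* = b/a`,
`E[ln Θ] = ln a + 1/n - ln b_* / (b_*^n - 1)`; consequently the estimator `θ̂_SC`
determined by `ln θ̂_SC = E[ln Θ]` equals `a · exp{1/n - ln b_* / (b_*^n - 1)}`. -/
theorem stmt_16 (n : ℕ) (hn : 1 ≤ n) (a b : ℝ) (ha : 0 < a) (hab : a < b) :
    (∫ t : ℝ, Real.log t ∂(paretoTrunc (n : ℝ) a b))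
      = Real.log a + 1 / n - Real.log (b / a) / ((b / a) ^ n - 1) ∧
    Real.exp (∫ t : ℝ, Real.log t ∂(paretoTrunc (n : ℝ) a b))
      = a * Real.exp (1 / n - Real.log (b / a) / ((b / a) ^ n - 1)) := by
  have h := integral_log_paretoTrunc (α := n) (by positivity) ha hab
  rw [Real.rpow_natCast] at h
  refine ⟨h, ?_⟩
  rw [h, add_sub_assoc, Real.exp_add, Real.exp_log ha]
end
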